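/- Let 2 ≤ k ≤ n be integers, let 1 ≤ l ≤ k−2, let λ ∈ Γ_k, and let 1 ≤ i ≤ n. Then σ_{l−1}(λ|i)·σ_{k−1}(λ) ≤ σ_l(λ)·σ_{k−2}(λ|i); that is, the partial derivative of the quotient σ_l/σ_{k−1} with respect to λ_i is nonpositive on Γ_k. -/

import Mathlib

/-- The `m`-th elementary symmetric function of `λ = (λ_1, …, λ_n) ∈ ℝⁿ`. -/
def esymm (n m : ℕ) (lam : Fin n → ℝ) : ℝ :=
  ∑ s ∈ (Finset.univ : Finset (Fin n)).powersetCard m, ∏ i ∈ s, lam i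

/-- The Gårding cone `Γ_k = {λ ∈ ℝⁿ : σ_j(λ) > 0 for all 1 ≤ j ≤ k}`. -/
def GardingCone (n m : ℕ) : Set (Fin n → ℝ) :=
  {lam | ∀ j : ℕ, 1 ≤ j → j ≤ m → 0 < esymm n j lam}

namespace Polynomial

theorem Splits.derivative_real {p : ℝ[X]} (hp : p.Splits) : (derivative p).Splits := by
  rw [splits_iff_card_roots] at hp ⊢
  have h₁ := card_roots_le_derivative p
  have h₂ := natDegree_derivative_le p
  have h₃ := card_roots' (derivative p)
  omega

theorem Splits.two_mul_coeff_zero_mul_coeff_two_le {p : ℝ[X]} (hp : p.Splits) :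
    2 * (p.coeff 0 * p.coeff 2) ≤ p.coeff 1 ^ 2 := by
  induction hp using Submonoid.closure_induction with
  | mem x hx =>
    rcases hx with ⟨a, rfl⟩ | ⟨a, rfl⟩
    · simp [coeff_C]
    · simp [coeff_X, coeff_C]
  | one => simp [coeff_one]
  | mul f g _ _ hf hg =>
    have h₁ : (f * g).coeff 1 = f.coeff 0 * g.coeff 1 + f.coeff 1 * g.coeff 0 := by
      simp [coeff_mul, Finset.Nat.antidiagonal_succ]
    have h₂ : (f * g).coeff 2 =
        f.coeff 0 * g.coeff 2 + f.coeff 1 * g.coeff 1 + f.coeff 2 * g.coeff 0 := by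
      simp [coeff_mul, Finset.Nat.antidiagonal_succ]
      ring
    rw [mul_coeff_zero, h₁, h₂]
    linarith [mul_le_mul_of_nonneg_left hf (sq_nonneg (g.coeff 0)),
      mul_le_mul_of_nonneg_left hg (sq_nonneg (f.coeff 0))]

theorem Splits.add_two_mul_coeff_mul_coeff_le (m : ℕ) {p : ℝ[X]} (hp : p.Splits) :
    ((m : ℝ) + 2) * (p.coeff m * p.coeff (m + 2)) ≤ (m + 1) * p.coeff (m + 1) ^ 2 := by
  induction m generalizing p with
  | zero => simpa using hp.two_mul_coeff_zero_mul_coeff_two_le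
  | succ m ih =>
    have h := ih hp.derivative_real
    simp only [coeff_derivative] at h
    push_cast at h ⊢
    have hm : (0 : ℝ) < (m + 1) * (m + 2) := by positivity
    refine le_of_mul_le_mul_left ?_ hm
    linarith

theorem Splits.coeff_mul_coeff_le_sq (m : ℕ) {p : ℝ[X]} (hp : p.Splits) :
    p.coeff m * p.coeff (m + 2) ≤ p.coeff (m + 1) ^ 2 := by
  have h := hp.add_two_mul_coeff_mul_coeff_le m
  have hm : (0 : ℝ) ≤ m := m.cast_nonneg
  by_contra! hlt
  nlinarith [sq_nonneg (p.coeff (m + 1)), mul_le_mul_of_nonneg_left hlt.le hm]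

end Polynomial

open Polynomial in
theorem coeff_prod_one_add_C_mul_X (n m : ℕ) (lam : Fin n → ℝ) :
    (∏ i, (1 + C (lam i) * X)).coeff m = esymm n m lam := by
  simp only [Finset.prod_one_add, finsetSum_coeff, Finset.prod_mul_distrib, Finset.prod_const,
    ← map_prod, coeff_C_mul, coeff_X_pow, mul_ite, mul_one, mul_zero, esymm,
    ← Finset.sum_filter, Finset.powersetCard_eq_filter, eq_comm]

theorem esymm_zero (n : ℕ) (lam : Fin n → ℝ) : esymm n 0 lam = 1 := by
  simp [esymm]

theorem esymm_mul_esymm_le_sq (n m : ℕ) (lam : Fin n → ℝ) :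
    esymm n m lam * esymm n (m + 2) lam ≤ esymm n (m + 1) lam ^ 2 := by
  simp only [← coeff_prod_one_add_C_mul_X]
  refine (Polynomial.Splits.prod fun i _ ↦ ?_).coeff_mul_coeff_le_sq m
  refine Polynomial.Splits.of_natDegree_le_one ?_
  compute_degree

open Polynomial in
theorem esymm_succ_eq_update (n m : ℕ) (lam : Fin n → ℝ) (i : Fin n) :
    esymm n (m + 1) lam = esymm n (m + 1) (Function.update lam i 0) +
      lam i * esymm n m (Function.update lam i 0) := by
  have h : ∏ j, (1 + C (lam j) * X) =
      (∏ j, (1 + C (Function.update lam i 0 j) * X)) * (1 + C (lam i) * X) := by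
    rw [Fintype.prod_eq_mul_prod_compl i, Fintype.prod_eq_mul_prod_compl i, mul_comm]
    simp only [Function.update_self, map_zero, zero_mul, add_zero, one_mul]
    congr 1
    refine Finset.prod_congr rfl fun j hj ↦ ?_
    rw [Function.update_of_ne (by simpa using hj)]
  simp only [← coeff_prod_one_add_C_mul_X]
  rw [h, mul_add, mul_one, ← mul_assoc, Polynomial.coeff_add, Polynomial.coeff_mul_X,
    Polynomial.coeff_mul_C, mul_comm (lam i)]

/-- Setting one entry of a point of `Γ_{k+1}` to zero gives a point of `Γ_k`. -/
theorem esymm_update_pos {n k : ℕ} {lam : Fin n → ℝ} (hlam : lam ∈ GardingCone n (k + 1))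
    (i : Fin n) {j : ℕ} (hj : j ≤ k) : 0 < esymm n j (Function.update lam i 0) := by
  induction j with
  | zero => simp [esymm_zero]
  | succ j ih =>
    have hpos := ih (by omega)
    have h₁ := hlam (j + 1) (by omega) (by omega)
    have h₂ := hlam (j + 2) (by omega) (by omega)
    rw [esymm_succ_eq_update n _ lam i] at h₁ h₂
    have newton := esymm_mul_esymm_le_sq n j (Function.update lam i 0)
    by_contra! hle
    nlinarith [mul_pos hpos h₂, mul_nonneg (neg_nonneg.2 hle) h₁.le]

theorem esymm_mul_esymm_le_of_pos {n a : ℕ} {mu : Fin n → ℝ} (d : ℕ)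
    (hmu : ∀ j ≤ a + d + 1, 0 < esymm n j mu) :
    esymm n a mu * esymm n (a + d + 2) mu ≤ esymm n (a + 1) mu * esymm n (a + d + 1) mu := by
  induction d with
  | zero => simpa [sq] using esymm_mul_esymm_le_sq n a mu
  | succ d ih =>
    have h := ih fun j hj ↦ hmu j (by omega)
    have newton : esymm n (a + d + 1) mu * esymm n (a + d + 3) mu ≤ esymm n (a + d + 2) mu ^ 2 :=
      esymm_mul_esymm_le_sq n (a + d + 1) mu
    have h₀ := hmu a (by omega)
    have h₁ := hmu (a + d + 1) (by omega)
    have h₂ := hmu (a + d + 2) (by omega)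
    change esymm n a mu * esymm n (a + d + 3) mu ≤ esymm n (a + 1) mu * esymm n (a + d + 2) mu
    refine le_of_mul_le_mul_left ?_ h₁
    linarith [mul_le_mul_of_nonneg_left newton h₀.le, mul_le_mul_of_nonneg_right h h₂.le]

/-- For `2 ≤ k ≤ n`, `1 ≤ l ≤ k-2`, `λ ∈ Γ_k` and `1 ≤ i ≤ n`:
`σ_{l-1}(λ|i)·σ_{k-1}(λ) ≤ σ_l(λ)·σ_{k-2}(λ|i)`, i.e. the partial derivative of
`σ_l/σ_{k-1}` with respect to `λ_i` is nonpositive on `Γ_k`. -/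
theorem quotient_deriv_nonpos (n k l : ℕ) (hk : 2 ≤ k) (hkn : k ≤ n)
    (hl : 1 ≤ l) (hlk : l ≤ k - 2)
    (lam : Fin n → ℝ) (hlam : lam ∈ GardingCone n k) (i : Fin n) :
    esymm n (l - 1) (Function.update lam i 0) * esymm n (k - 1) lam ≤
      esymm n l lam * esymm n (k - 2) (Function.update lam i 0) := by
  obtain ⟨a, rfl⟩ : ∃ a, l = a + 1 := ⟨l - 1, by omega⟩
  obtain ⟨d, rfl⟩ : ∃ d, k = a + d + 3 := ⟨k - a - 3, by omega⟩
  have h := esymm_mul_esymm_le_of_pos (n := n) (a := a) (mu := Function.update lam i 0) d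
    fun j hj ↦ esymm_update_pos hlam i (by omega)
  have hk₁ : a + d + 3 - 1 = a + d + 1 + 1 := rfl
  have hk₂ : a + d + 3 - 2 = a + d + 1 := rfl
  rw [Nat.add_sub_cancel, hk₁, hk₂, esymm_succ_eq_update n (a + d + 1) lam i,
    esymm_succ_eq_update n a lam i]
  linarith
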